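/- Let k, l ∈ ℤ be not both zero and let v = v₁+iv₂ ∈ ℤ[i]. Let ν₁, ν₂, ν₄ denote the numbers of orbits of β_v on G of cardinality 1, 2 and 4 respectively. Write k²+l² = 4q+r with q ≥ 0 an integer and r ∈ {0,1,2} (note k²+l² is never congruent to 3 modulo 4). Then: if r = 1 then (ν₁,ν₂,ν₄) = (1,0,q); if r = 0 then (ν₁,ν₂,ν₄) = (2,1,q−1) when v₁ ≡ v₂ (mod 2) and (ν₁,ν₂,ν₄) = (0,0,q) when v₁ ≢ v₂ (mod 2); if r = 2 then (ν₁,ν₂,ν₄) = (2,0,q) when v₁ ≡ v₂ (mod 2) and (ν₁,ν₂,ν₄) = (0,1,q) when v₁ ≢ v₂ (mod 2). In particular the total number of orbits of β_v is q+2, q+1, q, q+1 or q+2 in the respective cases, and ν₁ ∈ {0,1,2} with ν₁ ≡ k²+l² (mod 2). -/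

import Mathlib

/-- `x` and `y` lie in the same orbit of (the `ℤ`-action generated by) the selfmap `f`. -/
def OrbitRel {α : Type*} (f : α → α) (x y : α) : Prop := ∃ i j : ℕ, f^[i] x = f^[j] y

theorem orb_iff {α : Type*} (f : α → α) (hf : ∀ x, f (f (f (f x))) = x) (x y : α) :
    Quot.mk (OrbitRel f) y = Quot.mk (OrbitRel f) x ↔
      y = x ∨ y = f x ∨ y = f (f x) ∨ y = f (f (f x)) := by
  have key : ∀ i (x : α), f^[i] x = x ∨ f^[i] x = f x ∨ f^[i] x = f (f x) ∨ f^[i] x = f (f (f x)) := by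
    intro i x
    induction i with
    | zero => left; rfl
    | succ n ih =>
      rw [Function.iterate_succ_apply']
      rcases ih with h | h | h | h <;> rw [h] <;> simp [hf]
  constructor
  · intro h0
    have h := Quot.eqvGen_exact h0
    clear h0
    induction h with
    | rel a b h =>
      obtain ⟨i, j, h⟩ := h
      have h1 := key i a
      have h2 := key j b
      rw [h] at h1
      grind
    | refl a => simp
    | symm a b _ ih => grind
    | trans a b c _ _ h1 h2 => grind
  · intro h
    apply Quot.sound
    rcases h with h | h | h | h <;> subst h
    · exact ⟨0, 0, rfl⟩
    · exact ⟨0, 1, rfl⟩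
    · exact ⟨0, 2, rfl⟩
    · exact ⟨0, 3, rfl⟩

theorem fib_card {α : Type*} (f : α → α) (hf : ∀ x, f (f (f (f x))) = x) (x : α) :
    (f x = x ∧ Nat.card {y // Quot.mk (OrbitRel f) y = Quot.mk (OrbitRel f) x} = 1) ∨
    (f x ≠ x ∧ f (f x) = x ∧ Nat.card {y // Quot.mk (OrbitRel f) y = Quot.mk (OrbitRel f) x} = 2) ∨
    (f x ≠ x ∧ f (f x) ≠ x ∧ Nat.card {y // Quot.mk (OrbitRel f) y = Quot.mk (OrbitRel f) x} = 4) := by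
  classical
  have e : Nat.card {y // Quot.mk (OrbitRel f) y = Quot.mk (OrbitRel f) x}
      = ({x, f x, f (f x), f (f (f x))} : Finset α).card := by
    have := Nat.subtype_card (p := fun y => Quot.mk (OrbitRel f) y = Quot.mk (OrbitRel f) x) ({x, f x, f (f x), f (f (f x))} : Finset α) (by intro y; rw [orb_iff f hf]; simp)
    exact this
  rw [e]
  by_cases h1 : f x = x
  · left; simp [h1]
  by_cases h2 : f (f x) = x
  · right; left
    refine ⟨h1, h2, ?_⟩
    have : ({x, f x, f (f x), f (f (f x))} : Finset α) = {x, f x} := by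
      ext; simp [h2]
    rw [this, Finset.card_pair (Ne.symm h1)]
  · right; right
    refine ⟨h1, h2, ?_⟩
    have hi : ∀ a b, f a = f b → a = b := fun a b h => by rw [← hf a, h, hf]
    rw [Finset.card_insert_of_notMem, Finset.card_insert_of_notMem, Finset.card_pair] <;> simp <;> grind

theorem nu_card {α : Type*} [Finite α] (f : α → α) (c : ℕ) :
    c * Nat.card {o : Quot (OrbitRel f) // Nat.card {y // Quot.mk (OrbitRel f) y = o} = c} =
    Nat.card {x : α // Nat.card {y // Quot.mk (OrbitRel f) y = Quot.mk (OrbitRel f) x} = c} := by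
  classical
  have e : {x : α // Nat.card {y // Quot.mk (OrbitRel f) y = Quot.mk (OrbitRel f) x} = c} ≃
     (Σ o : {o : Quot (OrbitRel f) // Nat.card {y // Quot.mk (OrbitRel f) y = o} = c},
       {y // Quot.mk (OrbitRel f) y = o.1}) :=
    { toFun := fun x => ⟨⟨_, x.2⟩, ⟨x.1, rfl⟩⟩
      invFun := fun p => ⟨p.2.1, by rw [p.2.2]; exact p.1.2⟩
      left_inv := fun x => rfl
      right_inv := by rintro ⟨⟨o, ho⟩, ⟨y, hy⟩⟩; dsimp only at hy; subst hy; rfl }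
  have := Fintype.ofFinite {o : Quot (OrbitRel f) // Nat.card {y // Quot.mk (OrbitRel f) y = o} = c}
  rw [Nat.card_congr e, Nat.card_sigma, Finset.sum_congr rfl (fun o _ => o.2)]
  simp [mul_comm]

theorem split2 {β : Type*} [Finite β] (g : β → ℕ) :
    Nat.card {b // g b = 1 ∨ g b = 2} = Nat.card {b // g b = 1} + Nat.card {b // g b = 2} := by
  classical
  have := Fintype.ofFinite β
  simp only [Nat.subtype_card (Finset.univ.filter _) (fun x => Finset.mem_filter_univ x)]
  rw [← Finset.card_union_of_disjoint]
  · congr 1; ext b; simp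
  · rw [Finset.disjoint_left]; intro b; simp; omega

theorem split3 {β : Type*} [Finite β] (g : β → ℕ) (hg : ∀ b, g b = 1 ∨ g b = 2 ∨ g b = 4) :
    Nat.card β = Nat.card {b // g b = 1} + Nat.card {b // g b = 2} + Nat.card {b // g b = 4} := by
  classical
  have := Fintype.ofFinite β
  rw [Nat.card_eq_fintype_card, ← Finset.card_univ]
  simp only [Nat.subtype_card (Finset.univ.filter _) (fun x => Finset.mem_filter_univ x)]
  rw [← Finset.card_union_of_disjoint, ← Finset.card_union_of_disjoint]
  · congr 1; ext b; simp; have := hg b; tauto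
  · rw [Finset.disjoint_left]; intro b; simp; omega
  · rw [Finset.disjoint_left]; intro b; simp; omega

theorem orbit_counts {α : Type*} [Finite α] (f : α → α) (hf : ∀ x, f (f (f (f x))) = x) (ν : ℕ → ℕ)
    (hν : ∀ c, ν c = Nat.card {o : Quot (OrbitRel f) // Nat.card {y // Quot.mk (OrbitRel f) y = o} = c}) :
    ν 1 = Nat.card {x // f x = x} ∧ ν 1 + 2 * ν 2 = Nat.card {x // f (f x) = x} ∧
    ν 1 + 2 * ν 2 + 4 * ν 4 = Nat.card α ∧ Nat.card (Quot (OrbitRel f)) = ν 1 + ν 2 + ν 4 := by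
  classical
  have := Fintype.ofFinite α
  have := Fintype.ofFinite (Quot (OrbitRel f))
  have h1 := nu_card f 1
  have h2 := nu_card f 2
  have h4 := nu_card f 4
  rw [← hν] at h1 h2 h4
  have k := fib_card f hf
  have kq : ∀ o : Quot (OrbitRel f), Nat.card {y // Quot.mk (OrbitRel f) y = o} = 1 ∨ Nat.card {y // Quot.mk (OrbitRel f) y = o} = 2 ∨ Nat.card {y // Quot.mk (OrbitRel f) y = o} = 4 := by
    intro o
    induction o using Quot.ind with
    | mk x => have := k x; tauto
  have s1 := split3 _ kq
  have s2 := split3 (fun x => Nat.card {y // Quot.mk (OrbitRel f) y = Quot.mk (OrbitRel f) x}) (fun x => kq _)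
  have a1 : Nat.card {x // f x = x} = Nat.card {x : α // Nat.card {y // Quot.mk (OrbitRel f) y = Quot.mk (OrbitRel f) x} = 1} := by
    apply Nat.card_congr; apply Equiv.subtypeEquivRight
    intro x; have := k x
    grind
  have a2 : Nat.card {x // f (f x) = x} = Nat.card {x : α // Nat.card {y // Quot.mk (OrbitRel f) y = Quot.mk (OrbitRel f) x} = 1} + Nat.card {x : α // Nat.card {y // Quot.mk (OrbitRel f) y = Quot.mk (OrbitRel f) x} = 2} := by
    rw [← split2]
    apply Nat.card_congr; apply Equiv.subtypeEquivRight
    intro x; have := k x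
    grind
  rw [← hν, ← hν, ← hν] at s1
  refine ⟨?_, ?_, ?_, s1⟩ <;> omega


def gaussEquiv : GaussianInt ≃ₗ[ℤ] (Fin 2 → ℤ) where
  toFun z := ![z.re, z.im]
  invFun f := ⟨f 0, f 1⟩
  map_add' a b := by ext i; fin_cases i <;> simp
  map_smul' a b := by ext i; fin_cases i <;> simp
  left_inv a := by simp
  right_inv a := by ext i; fin_cases i <;> simp

theorem card_quot (w : GaussianInt) :
    Nat.card (GaussianInt ⧸ Ideal.span {w}) = (w.re ^ 2 + w.im ^ 2).natAbs := by
  let b := Module.Basis.ofEquivFun gaussEquiv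
  have : Module.Free ℤ GaussianInt := Module.Free.of_basis b
  have : Module.Finite ℤ GaussianInt := Module.Finite.of_basis b
  have h := Ideal.absNorm_span_singleton w
  rw [Ideal.absNorm_apply, Submodule.cardQuot_apply] at h
  rw [h, Algebra.norm_eq_matrix_det b, Matrix.det_fin_two]
  congr 1
  have b0 : b 0 = ⟨1, 0⟩ := by simp [b, gaussEquiv]
  have b1 : b 1 = ⟨0, 1⟩ := by simp [b, gaussEquiv]
  have e0 : ∀ z, b.repr z 0 = z.re := by intro z; simp [b, gaussEquiv]
  have e1 : ∀ z, b.repr z 1 = z.im := by intro z; simp [b, gaussEquiv]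
  simp only [Algebra.leftMulMatrix_eq_repr_mul, b0, b1, e0, e1]
  simp
  ring

theorem sol_card (w c a m b z0 : GaussianInt) (hw : w = c * a) (hc : c ≠ 0)
    (h : ∀ z, w ∣ m * z ↔ c ∣ z) (h0 : w ∣ m * z0 - b) :
    Nat.card {g : GaussianInt ⧸ Ideal.span {w} //
      Ideal.Quotient.mk (Ideal.span {w}) m * g = Ideal.Quotient.mk (Ideal.span {w}) b} =
    (a.re ^ 2 + a.im ^ 2).natAbs := by
  rw [← card_quot a]
  symm
  have hS : ∀ z, Ideal.Quotient.mk (Ideal.span {w}) m * Ideal.Quotient.mk (Ideal.span {w}) z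
      = Ideal.Quotient.mk (Ideal.span {w}) b ↔ c ∣ z - z0 := by
    intro z
    rw [← map_mul, ← sub_eq_zero, ← map_sub, Ideal.Quotient.eq_zero_iff_dvd, ← h,
      show m * z - b = m * (z - z0) + (m * z0 - b) by ring, dvd_add_left h0]
  let F : GaussianInt ⧸ Ideal.span {a} → GaussianInt ⧸ Ideal.span {w} :=
    Quotient.lift (fun t => Ideal.Quotient.mk (Ideal.span {w}) (z0 + c * t)) (by
      intro s t hst
      have hst : Ideal.Quotient.mk (Ideal.span {a}) s = Ideal.Quotient.mk (Ideal.span {a}) t := Quotient.sound hst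
      rw [← sub_eq_zero, ← map_sub, Ideal.Quotient.eq_zero_iff_dvd] at hst
      rw [← sub_eq_zero, ← map_sub, Ideal.Quotient.eq_zero_iff_dvd, hw]
      rw [show z0 + c * s - (z0 + c * t) = c * (s - t) by ring]
      exact mul_dvd_mul_left c hst)
  have hF : ∀ t, F (Ideal.Quotient.mk _ t) = Ideal.Quotient.mk (Ideal.span {w}) (z0 + c * t) := fun t => rfl
  apply Nat.card_eq_of_bijective (fun t => ⟨F t, by
    obtain ⟨t, rfl⟩ := Ideal.Quotient.mk_surjective t
    rw [hF, hS]; exact ⟨t, by ring⟩⟩)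
  constructor
  · intro s t hst
    obtain ⟨s, rfl⟩ := Ideal.Quotient.mk_surjective s
    obtain ⟨t, rfl⟩ := Ideal.Quotient.mk_surjective t
    simp only [Subtype.mk.injEq, hF] at hst
    rw [← sub_eq_zero, ← map_sub, Ideal.Quotient.eq_zero_iff_dvd, hw,
      show z0 + c * s - (z0 + c * t) = c * (s - t) by ring, mul_dvd_mul_iff_left hc] at hst
    rw [← sub_eq_zero, ← map_sub, Ideal.Quotient.eq_zero_iff_dvd]
    exact hst
  · rintro ⟨g, hg⟩
    obtain ⟨z, rfl⟩ := Ideal.Quotient.mk_surjective g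
    obtain ⟨t, ht⟩ := (hS z).1 hg
    refine ⟨Ideal.Quotient.mk _ t, ?_⟩
    apply Subtype.ext
    refine (hF t).trans ?_
    dsimp only
    rw [ ← ht]; congr 1; ring

theorem sol_none (w p m b : GaussianInt) (hw : p ∣ w) (hm : p ∣ m) (hb : ¬ p ∣ b) :
    Nat.card {g : GaussianInt ⧸ Ideal.span {w} //
      Ideal.Quotient.mk (Ideal.span {w}) m * g = Ideal.Quotient.mk (Ideal.span {w}) b} = 0 := by
  rw [Nat.card_eq_zero]; left
  constructor
  rintro ⟨g, hg⟩
  obtain ⟨z, rfl⟩ := Ideal.Quotient.mk_surjective g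
  rw [← map_mul, ← sub_eq_zero, ← map_sub, Ideal.Quotient.eq_zero_iff_dvd] at hg
  exact hb ((dvd_sub_right (hm.mul_right z)).1 (hw.trans hg))

theorem pi_dvd (z : GaussianInt) : (⟨1, -1⟩ : GaussianInt) ∣ z ↔ z.re % 2 = z.im % 2 := by
  constructor
  · rintro ⟨t, rfl⟩
    simp; omega
  · intro h
    refine ⟨⟨(z.re - z.im) / 2, (z.re + z.im) / 2⟩, ?_⟩
    ext <;> simp <;> omega

theorem odd_dvd (u : GaussianInt) (n : ℤ) (h : u.re ^ 2 + u.im ^ 2 = 2 * n + 1) (z : GaussianInt) :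
    u ∣ 2 * z ↔ u ∣ z := by
  refine ⟨?_, fun h => h.mul_left 2⟩
  rintro ⟨t, ht⟩
  refine ⟨star u * z - n * t, ?_⟩
  have : u * star u = 2 * n + 1 := by
    ext <;> simp <;> linarith
  linear_combination (-z) * this - n * ht

theorem counts (k l : ℤ) (hkl : ¬(k = 0 ∧ l = 0))
    (v : GaussianInt) (q r : ℕ) (hr : r = 0 ∨ r = 1 ∨ r = 2)
    (hq : k ^ 2 + l ^ 2 = 4 * (q : ℤ) + (r : ℤ)) (A B : ℕ)
    (hA : A = Nat.card {g : GaussianInt ⧸ Ideal.span {(⟨k, l⟩ : GaussianInt)} //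
      Ideal.Quotient.mk (Ideal.span {(⟨k, l⟩ : GaussianInt)}) ⟨1, -1⟩ * g = Ideal.Quotient.mk (Ideal.span {(⟨k, l⟩ : GaussianInt)}) (⟨0, -1⟩ * v)})
    (hB : B = Nat.card {g : GaussianInt ⧸ Ideal.span {(⟨k, l⟩ : GaussianInt)} //
      Ideal.Quotient.mk (Ideal.span {(⟨k, l⟩ : GaussianInt)}) 2 * g = Ideal.Quotient.mk (Ideal.span {(⟨k, l⟩ : GaussianInt)}) (⟨1, -1⟩ * v)}) :
    (r = 1 → A = 1 ∧ B = 1) ∧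
    (r = 0 → v.re % 2 = v.im % 2 → A = 2 ∧ B = 4) ∧
    (r = 0 → v.re % 2 ≠ v.im % 2 → A = 0 ∧ B = 0) ∧
    (r = 2 → v.re % 2 = v.im % 2 → A = 2 ∧ B = 2) ∧
    (r = 2 → v.re % 2 ≠ v.im % 2 → A = 0 ∧ B = 2) := by
  obtain ⟨w, hw⟩ : ∃ w : GaussianInt, w = ⟨k, l⟩ := ⟨_, rfl⟩
  have hk : w.re = k := by rw [hw]
  have hl : w.im = l := by rw [hw]
  obtain ⟨p, hp⟩ : ∃ p : GaussianInt, p = ⟨1, -1⟩ := ⟨_, rfl⟩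
  obtain ⟨p', hp'⟩ : ∃ p : GaussianInt, p = ⟨1, 1⟩ := ⟨_, rfl⟩
  obtain ⟨I, hI⟩ : ∃ p : GaussianInt, p = ⟨0, -1⟩ := ⟨_, rfl⟩
  have hpd := pi_dvd
  rw [← hw, ← hp, ← hI] at hA
  rw [← hw, ← hp] at hB
  rw [← hp] at hpd
  rw [← hk, ← hl] at hq
  have w0 : w ≠ 0 := by
    rintro rfl; exact hkl ⟨hk.symm, hl.symm⟩
  have pp : p' * p = 2 := by rw [hp, hp']; rfl
  have II : I * I = -1 := by rw [hI]; rfl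
  have p2 : p' = - I * p := by rw [hp, hp', hI]; rfl
  have p0 : p ≠ 0 := by rintro rfl; simp at pp
  have p'0 : p' ≠ 0 := by rintro rfl; simp at pp
  have np : (p.re ^ 2 + p.im ^ 2).natAbs = 2 := by rw [hp]; rfl
  have ns : ∀ u : GaussianInt, u * star u = ((u.re ^ 2 + u.im ^ 2 : ℤ) : GaussianInt) := by
    intro u; ext <;> simp [-Int.cast_add, -Int.cast_pow] <;> ring
  clear hk hl hw
  refine ⟨?_, ?_, ?_, ?_, ?_⟩
  · rintro rfl
    have hn : w * star w = 4 * (q : GaussianInt) + 1 := by rw [ns, hq]; push_cast; ring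
    have od := odd_dvd w (2 * q) (by rw [hq]; push_cast; ring)
    rw [hA, hB, sol_card w w 1 p (I * v) (-2 * q * p' * (I * v)) (by ring) w0 ?_ ?_,
      sol_card w w 1 2 (p * v) (-2 * q * (p * v)) (by ring) w0 ?_ ?_]
    · exact ⟨rfl, rfl⟩
    · exact od
    · exact ⟨- star w * p * v, by linear_combination (p * v) * hn⟩
    · intro z
      refine ⟨fun h => ?_, fun h => h.mul_left p⟩
      rw [← od, ← pp, mul_assoc]
      exact h.mul_left p'
    · exact ⟨- star w * I * v, by linear_combination (I * v) * hn - 2 * q * I * v * pp⟩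
  all_goals
    rintro rfl hv
    obtain ⟨u, hu⟩ : p ∣ w := by
      rw [hpd]
      have : (w.re ^ 2 + w.im ^ 2) % 2 = 0 := by rw [hq]; push_cast; omega
      rcases Int.emod_two_eq_zero_or_one w.re with h1 | h1 <;>
      rcases Int.emod_two_eq_zero_or_one w.im with h2 | h2 <;>
      simp [pow_two, Int.add_emod, Int.mul_emod, h1, h2] at this ⊢
    have nw : w.re ^ 2 + w.im ^ 2 = 2 * (u.re ^ 2 + u.im ^ 2) := by rw [hu, hp]; simp; ring
    have u0 : u ≠ 0 := by rintro rfl; simp at hu; exact w0 hu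
    have Asol : v.re % 2 = v.im % 2 → A = 2 := by
      intro hv
      obtain ⟨v', rfl⟩ := (hpd v).2 hv
      rw [hA, sol_card w u p p (I * (p * v')) (I * v') (by rw [hu]; ring) u0 ?_ ?_, np]
      · intro z; rw [hu, mul_dvd_mul_iff_left p0]
      · exact ⟨0, by ring⟩
    have Ano : v.re % 2 ≠ v.im % 2 → A = 0 := by
      intro hv
      rw [hA]
      apply sol_none w p _ _ ⟨u, hu⟩ (dvd_refl p)
      intro h
      apply hv
      rw [← hpd]
      have := h.mul_left I
      rw [← mul_assoc, II] at this
      simpa using this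
  · refine ⟨Asol hv, ?_⟩
    obtain ⟨c, rfl⟩ : p ∣ u := by
      rw [hpd]
      have : (u.re ^ 2 + u.im ^ 2) % 2 = 0 := by omega
      rcases Int.emod_two_eq_zero_or_one u.re with h1 | h1 <;>
      rcases Int.emod_two_eq_zero_or_one u.im with h2 | h2 <;>
      simp [pow_two, Int.add_emod, Int.mul_emod, h1, h2] at this ⊢
    obtain ⟨v', rfl⟩ := (hpd v).2 hv
    have hw2 : w = 2 * (I * c) := by rw [hu]; linear_combination I * c * (pp - p * p2) + p * p * c * II
    have ic0 : I * c ≠ 0 := by intro h; rw [h] at hw2; simp at hw2; exact w0 hw2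
    rw [hB, sol_card w (I * c) 2 2 (p * (p * v')) (I * v') (by rw [hw2]; ring) ic0 ?_ ?_]
    · rfl
    · intro z; rw [hw2, mul_dvd_mul_iff_left (by norm_num)]
    · exact ⟨0, by linear_combination - I * v' * (pp - p * p2) - p * p * v' * II⟩
  · refine ⟨Ano hv, ?_⟩
    obtain ⟨c, rfl⟩ : p ∣ u := by
      rw [hpd]
      have : (u.re ^ 2 + u.im ^ 2) % 2 = 0 := by omega
      rcases Int.emod_two_eq_zero_or_one u.re with h1 | h1 <;>
      rcases Int.emod_two_eq_zero_or_one u.im with h2 | h2 <;>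
      simp [pow_two, Int.add_emod, Int.mul_emod, h1, h2] at this ⊢
    rw [hB]
    apply sol_none w (p * p) _ _ ⟨c, by rw [hu]; ring⟩ ⟨-I, by linear_combination p * p2 - pp⟩
    rw [mul_dvd_mul_iff_left p0, hpd]
    exact hv
  all_goals
    have B2 : B = 2 := by
      have hn' : u.re ^ 2 + u.im ^ 2 = 2 * q + 1 := by push_cast at hq; omega
      have hn : u * star u = 2 * (q : GaussianInt) + 1 := by rw [ns, hn']; push_cast; ring
      have od := odd_dvd u q hn'
      rw [hB, sol_card w u p 2 (p * v) (-q * (p * v)) (by rw [hu]; ring) u0 ?_ ?_, np]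
      · intro z
        rw [hu, ← pp, mul_comm p' p, mul_assoc, mul_dvd_mul_iff_left p0]
        refine ⟨fun h => ?_, fun h => h.mul_left p'⟩
        rw [← od, ← pp, mul_comm p' p, mul_assoc]
        exact h.mul_left p
      · exact ⟨- star u * v, by rw [hu]; linear_combination (p * v) * hn⟩
  · exact ⟨Asol hv, B2⟩
  · exact ⟨Ano hv, B2⟩

theorem gaussian_main_aux (k l : ℤ) (hkl : ¬(k = 0 ∧ l = 0))
    (v : GaussianInt) (q r : ℕ) (hr : r = 0 ∨ r = 1 ∨ r = 2)
    (hq : k ^ 2 + l ^ 2 = 4 * (q : ℤ) + (r : ℤ)) :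
    let J : Ideal GaussianInt := Ideal.span {(⟨k, l⟩ : GaussianInt)}
    let β : (GaussianInt ⧸ J) → (GaussianInt ⧸ J) :=
      fun g => Ideal.Quotient.mk J (⟨0, 1⟩ : GaussianInt) * (g - Ideal.Quotient.mk J v)
    -- `ν c` is the number of orbits of `β_v` of cardinality `c`
    let ν : ℕ → ℕ := fun c => Nat.card {o : Quot (OrbitRel β) //
      Nat.card {y : GaussianInt ⧸ J // Quot.mk (OrbitRel β) y = o} = c}
    -- the total number of orbits of `β_v`
    let total : ℕ := Nat.card (Quot (OrbitRel β))
    (r = 1 → ν 1 = 1 ∧ ν 2 = 0 ∧ ν 4 = q ∧ total = q + 1) ∧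
    (r = 0 → v.re % 2 = v.im % 2 →
      ν 1 = 2 ∧ ν 2 = 1 ∧ (ν 4 : ℤ) = (q : ℤ) - 1 ∧ total = q + 2) ∧
    (r = 0 → v.re % 2 ≠ v.im % 2 → ν 1 = 0 ∧ ν 2 = 0 ∧ ν 4 = q ∧ total = q) ∧
    (r = 2 → v.re % 2 = v.im % 2 → ν 1 = 2 ∧ ν 2 = 0 ∧ ν 4 = q ∧ total = q + 2) ∧
    (r = 2 → v.re % 2 ≠ v.im % 2 → ν 1 = 0 ∧ ν 2 = 1 ∧ ν 4 = q ∧ total = q + 1) ∧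
    (ν 1 = 0 ∨ ν 1 = 1 ∨ ν 1 = 2) ∧
    ((ν 1 : ℤ) % 2 = (k ^ 2 + l ^ 2) % 2) := by
  intro J β ν total
  have hN := card_quot ⟨k, l⟩
  have hpos : 0 < k ^ 2 + l ^ 2 := by
    by_contra hc
    apply hkl
    constructor <;> nlinarith [sq_nonneg k, sq_nonneg l]
  simp only at hN
  have hN' : Nat.card (GaussianInt ⧸ J) = 4 * q + r := by
    change Nat.card (GaussianInt ⧸ J) = _ at hN
    rw [hN]; omega
  have : Finite (GaussianInt ⧸ J) := Nat.finite_of_card_ne_zero (by omega)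
  have II : Ideal.Quotient.mk J (⟨0, 1⟩ : GaussianInt) * Ideal.Quotient.mk J (⟨0, 1⟩ : GaussianInt) = -1 := by
    rw [← map_mul, ← map_one (Ideal.Quotient.mk J), ← map_neg]; rfl
  have hp : Ideal.Quotient.mk J (⟨1, -1⟩ : GaussianInt) = 1 - Ideal.Quotient.mk J (⟨0, 1⟩ : GaussianInt) := by
    rw [← map_one (Ideal.Quotient.mk J), ← map_sub]; rfl
  have hI : Ideal.Quotient.mk J (⟨0, -1⟩ : GaussianInt) = - Ideal.Quotient.mk J (⟨0, 1⟩ : GaussianInt) := by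
    rw [← map_neg]; rfl
  have hβ : ∀ g, β g = Ideal.Quotient.mk J (⟨0, 1⟩ : GaussianInt) * (g - Ideal.Quotient.mk J v) := fun g => rfl
  have hβ2 : ∀ g, β (β g) = - g + Ideal.Quotient.mk J (⟨1, -1⟩ * v) := by
    intro g
    rw [hβ, hβ, map_mul, hp]
    linear_combination (g - Ideal.Quotient.mk J v) * II
  have hβ4 : ∀ g, β (β (β (β g))) = g := by
    intro g; rw [hβ2, hβ2]; ring
  obtain ⟨o1, o2, o4, ot⟩ := orbit_counts β hβ4 ν (fun c => rfl)
  have eA : Nat.card {x // β x = x} = Nat.card {g : GaussianInt ⧸ J //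
      Ideal.Quotient.mk J ⟨1, -1⟩ * g = Ideal.Quotient.mk J (⟨0, -1⟩ * v)} := by
    apply Nat.card_congr; apply Equiv.subtypeEquivRight
    intro g
    rw [hβ, map_mul, hp, hI]
    constructor <;> intro h <;> linear_combination -h
  have eB : Nat.card {x // β (β x) = x} = Nat.card {g : GaussianInt ⧸ J //
      Ideal.Quotient.mk J 2 * g = Ideal.Quotient.mk J (⟨1, -1⟩ * v)} := by
    apply Nat.card_congr; apply Equiv.subtypeEquivRight
    intro g
    rw [hβ2, map_ofNat]
    constructor <;> intro h <;> linear_combination -h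
  have hc := counts k l hkl v q r hr hq _ _ eA eB
  rw [← o1, ← o2] at hc
  rw [hN'] at o4
  have ot' : total = ν 1 + ν 2 + ν 4 := ot
  clear_value total ν
  rw [hq]
  obtain ⟨c1, c2, c3, c4, c5⟩ := hc
  clear hβ4 hβ2 hβ
  rcases hr with rfl | rfl | rfl <;> by_cases hv : v.re % 2 = v.im % 2 <;>
    simp [hv] at c1 c2 c3 c4 c5 ⊢ <;> omega

theorem gaussian_beta_orbit_numbers (k l : ℤ) (hkl : ¬(k = 0 ∧ l = 0))
    (v : GaussianInt) (q r : ℕ) (hr : r = 0 ∨ r = 1 ∨ r = 2)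
    (hq : k ^ 2 + l ^ 2 = 4 * (q : ℤ) + (r : ℤ)) :
    letI J : Ideal GaussianInt := Ideal.span {(⟨k, l⟩ : GaussianInt)}
    letI β : (GaussianInt ⧸ J) → (GaussianInt ⧸ J) :=
      fun g => Ideal.Quotient.mk J (⟨0, 1⟩ : GaussianInt) * (g - Ideal.Quotient.mk J v)
    -- `ν c` is the number of orbits of `β_v` of cardinality `c`
    letI ν : ℕ → ℕ := fun c => Nat.card {o : Quot (OrbitRel β) //
      Nat.card {y : GaussianInt ⧸ J // Quot.mk (OrbitRel β) y = o} = c}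
    -- the total number of orbits of `β_v`
    letI total : ℕ := Nat.card (Quot (OrbitRel β))
    (r = 1 → ν 1 = 1 ∧ ν 2 = 0 ∧ ν 4 = q ∧ total = q + 1) ∧
    (r = 0 → v.re % 2 = v.im % 2 →
      ν 1 = 2 ∧ ν 2 = 1 ∧ (ν 4 : ℤ) = (q : ℤ) - 1 ∧ total = q + 2) ∧
    (r = 0 → v.re % 2 ≠ v.im % 2 → ν 1 = 0 ∧ ν 2 = 0 ∧ ν 4 = q ∧ total = q) ∧
    (r = 2 → v.re % 2 = v.im % 2 → ν 1 = 2 ∧ ν 2 = 0 ∧ ν 4 = q ∧ total = q + 2) ∧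
    (r = 2 → v.re % 2 ≠ v.im % 2 → ν 1 = 0 ∧ ν 2 = 1 ∧ ν 4 = q ∧ total = q + 1) ∧
    (ν 1 = 0 ∨ ν 1 = 1 ∨ ν 1 = 2) ∧
    ((ν 1 : ℤ) % 2 = (k ^ 2 + l ^ 2) % 2) := by
  exact gaussian_main_aux k l hkl v q r hr hq
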